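/- For all integers n ≥ 1 and i ≥ 1, ∫_{-∞}^∞ (|t|^i/i!) · |h_n(t)| dt ≤ 1/√(2^n · n! · i! · √π). -/

import Mathlib

open MeasureTheory Finset

/-- Physicists' Hermite polynomial `H_n`. -/
noncomputable def hermiteP (n : ℕ) (t : ℝ) : ℝ :=
  (-1 : ℝ) ^ n * Real.exp (t ^ 2) * iteratedDeriv n (fun s : ℝ => Real.exp (-s ^ 2)) t

/-- Hermite function `h_n`. -/
noncomputable def hermiteFun (n : ℕ) (t : ℝ) : ℝ :=
  (1 / ((2 : ℝ) ^ n * (Nat.factorial n : ℝ) * Real.sqrt Real.pi)) * Real.exp (-t ^ 2) *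
    hermiteP n t

open Polynomial in
/-- The physicists' Hermite polynomial as an element of `ℝ[X]`. -/
noncomputable def physHermite : ℕ → ℝ[X]
  | 0 => 1
  | n + 1 => 2 * X * physHermite n - derivative (physHermite n)

open Polynomial in
theorem derivative_physHermite_succ (n : ℕ) :
    derivative (physHermite (n + 1)) = C (2 * ((n : ℝ) + 1)) * physHermite n := by
  induction n with
  | zero => simp [physHermite, C_ofNat]
  | succ n ih =>
    have h : physHermite (n + 2) =
        2 * X * physHermite (n + 1) - C (2 * ((n : ℝ) + 1)) * physHermite n := by
      rw [← ih]; rfl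
    have h' : derivative (physHermite n) =
        2 * X * physHermite n - physHermite (n + 1) := by
      simp [physHermite]
    rw [h, derivative_sub, derivative_mul, derivative_mul, ih, derivative_C_mul, h']
    simp only [derivative_X, derivative_ofNat, map_mul, map_add, map_natCast,
      map_one, map_ofNat, Nat.cast_add, Nat.cast_one]
    ring

theorem hasDerivAt_exp_neg_sq (t : ℝ) :
    HasDerivAt (fun s : ℝ => Real.exp (-s ^ 2)) (-(2 * t) * Real.exp (-t ^ 2)) t := by
  convert! ((hasDerivAt_pow 2 t).neg).exp using 1
  simp only [Pi.neg_apply]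
  push_cast
  ring

theorem Polynomial.hasDerivAt_eval_mul_exp_neg_sq (p : Polynomial ℝ) (t : ℝ) :
    HasDerivAt (fun s => p.eval s * Real.exp (-s ^ 2))
      ((p.derivative - 2 * Polynomial.X * p).eval t * Real.exp (-t ^ 2)) t := by
  convert! (p.hasDerivAt t).mul (hasDerivAt_exp_neg_sq t) using 1
  simp only [Polynomial.eval_sub, Polynomial.eval_mul, Polynomial.eval_X, Polynomial.eval_ofNat]
  ring

theorem iteratedDeriv_exp_neg_sq (n : ℕ) :
    iteratedDeriv n (fun s : ℝ => Real.exp (-s ^ 2)) =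
      fun t => (-1) ^ n * ((physHermite n).eval t * Real.exp (-t ^ 2)) := by
  induction n with
  | zero => simp [physHermite]
  | succ n ih =>
    funext t
    rw [iteratedDeriv_succ, ih,
      (((physHermite n).hasDerivAt_eval_mul_exp_neg_sq t).const_mul ((-1 : ℝ) ^ n)).deriv]
    simp only [physHermite, Polynomial.eval_sub, pow_succ]
    ring

theorem hermiteP_eq_eval (n : ℕ) (t : ℝ) : hermiteP n t = (physHermite n).eval t := by
  rw [hermiteP, iteratedDeriv_exp_neg_sq]
  calc _ = ((-1 : ℝ) * -1) ^ n * (Real.exp (t ^ 2) * Real.exp (-t ^ 2)) *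
        (physHermite n).eval t := by rw [mul_pow]; ring
    _ = _ := by rw [← Real.exp_add]; simp

theorem Polynomial.integrable_eval_mul_exp_neg_sq (p : Polynomial ℝ) :
    Integrable fun t => p.eval t * Real.exp (-t ^ 2) := by
  induction p using Polynomial.induction_on' with
  | add p q hp hq => simpa only [Polynomial.eval_add, add_mul] using! hp.add hq
  | monomial k a =>
    have h := integrable_rpow_mul_exp_neg_mul_sq one_pos
      (show (-1 : ℝ) < k from lt_of_lt_of_le (by norm_num) k.cast_nonneg)
    simpa [mul_assoc] using! h.const_mul a

/-- Integration of polynomials against the weight `exp (-t ^ 2)`. -/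
noncomputable def gaussianFunctional : Polynomial ℝ →ₗ[ℝ] ℝ where
  toFun p := ∫ t : ℝ, p.eval t * Real.exp (-t ^ 2)
  map_add' p q := by
    simp only [Polynomial.eval_add, add_mul]
    exact integral_add p.integrable_eval_mul_exp_neg_sq q.integrable_eval_mul_exp_neg_sq
  map_smul' a p := by
    simp only [Polynomial.eval_smul, smul_eq_mul, mul_assoc, integral_const_mul, RingHom.id_apply]

theorem gaussianFunctional_apply (p : Polynomial ℝ) :
    gaussianFunctional p = ∫ t : ℝ, p.eval t * Real.exp (-t ^ 2) := rfl

theorem gaussianFunctional_one : gaussianFunctional 1 = √Real.pi := by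
  simpa [gaussianFunctional_apply] using integral_gaussian 1

theorem gaussianFunctional_two_mul_X_mul (p : Polynomial ℝ) :
    gaussianFunctional (2 * Polynomial.X * p) = gaussianFunctional p.derivative := by
  have h : gaussianFunctional (p.derivative - 2 * Polynomial.X * p) = 0 :=
    integral_eq_zero_of_hasDerivAt_of_integrable p.hasDerivAt_eval_mul_exp_neg_sq
      (Polynomial.integrable_eval_mul_exp_neg_sq _) p.integrable_eval_mul_exp_neg_sq
  rw [map_sub] at h
  linarith

theorem gaussianFunctional_physHermite_succ_mul (n : ℕ) (q : Polynomial ℝ) :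
    gaussianFunctional (physHermite (n + 1) * q) =
      gaussianFunctional (physHermite n * q.derivative) := by
  have h := gaussianFunctional_two_mul_X_mul (physHermite n * q)
  rw [Polynomial.derivative_mul, map_add] at h
  rw [physHermite, sub_mul, map_sub, mul_assoc _ (physHermite n), h]
  ring

theorem gaussianFunctional_physHermite_sq (n : ℕ) :
    gaussianFunctional (physHermite n ^ 2) = 2 ^ n * (Nat.factorial n : ℝ) * √Real.pi := by
  induction n with
  | zero => simp [physHermite, gaussianFunctional_one]
  | succ n ih =>
    rw [sq, gaussianFunctional_physHermite_succ_mul, derivative_physHermite_succ,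
      mul_left_comm, ← sq, ← Polynomial.smul_eq_C_mul, map_smul, ih, Nat.factorial_succ]
    push_cast
    rw [smul_eq_mul]
    ring

theorem gaussianFunctional_X_pow_two_mul_succ (i : ℕ) :
    gaussianFunctional ((Polynomial.X ^ (i + 1)) ^ 2) =
      (i + 1 / 2) * gaussianFunctional ((Polynomial.X ^ i) ^ 2) := by
  have h := gaussianFunctional_two_mul_X_mul (Polynomial.X ^ (2 * i + 1))
  have h₁ : (2 * Polynomial.X * Polynomial.X ^ (2 * i + 1) : Polynomial ℝ) =
      (2 : ℝ) • (Polynomial.X ^ (i + 1)) ^ 2 := by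
    rw [Polynomial.smul_eq_C_mul, Polynomial.C_ofNat]; ring
  have h₂ : Polynomial.derivative (Polynomial.X ^ (2 * i + 1) : Polynomial ℝ) =
      (2 * i + 1 : ℝ) • (Polynomial.X ^ i) ^ 2 := by
    rw [Polynomial.derivative_X_pow, Polynomial.smul_eq_C_mul, ← pow_mul, mul_comm i 2]
    simp
  rw [h₁, h₂, map_smul, map_smul, smul_eq_mul, smul_eq_mul] at h
  linarith

theorem gaussianFunctional_X_pow_sq_le {i : ℕ} (hi : 1 ≤ i) :
    gaussianFunctional ((Polynomial.X ^ i) ^ 2) ≤ (Nat.factorial i : ℝ) := by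
  induction i, hi using Nat.le_induction with
  | base =>
    have h : √Real.pi ≤ 2 := by
      rw [Real.sqrt_le_left (by norm_num)]
      linarith [Real.pi_le_four]
    have h₁ := gaussianFunctional_X_pow_two_mul_succ 0
    simp only [pow_zero, one_pow, gaussianFunctional_one] at h₁
    norm_num at h₁ ⊢
    linarith
  | succ i hi ih =>
    rw [gaussianFunctional_X_pow_two_mul_succ, Nat.factorial_succ]
    push_cast
    exact mul_le_mul (by linarith) ih
      (integral_nonneg fun t => by simp only [Polynomial.eval_pow]; positivity) (by positivity)

/-- The Cauchy–Schwarz inequality for polynomials with respect to the weight `exp (-t ^ 2)`. -/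
theorem integral_abs_eval_mul_exp_neg_sq_le {p q : Polynomial ℝ} {A B : ℝ}
    (hA : 0 < A) (hB : 0 < B)
    (hp : gaussianFunctional (p ^ 2) ≤ A) (hq : gaussianFunctional (q ^ 2) ≤ B) :
    ∫ t : ℝ, |p.eval t| * |q.eval t| * Real.exp (-t ^ 2) ≤ √A * √B := by
  have ha := Real.sqrt_pos.2 hA
  have hb := Real.sqrt_pos.2 hB
  set r : Polynomial ℝ := (√B / (2 * √A)) • p ^ 2 + (√A / (2 * √B)) • q ^ 2 with hr
  calc ∫ t : ℝ, |p.eval t| * |q.eval t| * Real.exp (-t ^ 2)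
      ≤ gaussianFunctional r := by
        refine integral_mono_of_nonneg (.of_forall fun t => by positivity)
          r.integrable_eval_mul_exp_neg_sq (.of_forall fun t => ?_)
        refine mul_le_mul_of_nonneg_right ?_ (Real.exp_nonneg _)
        simp only [hr, Polynomial.eval_add, Polynomial.eval_smul, Polynomial.eval_pow, smul_eq_mul]
        rw [← sq_abs (p.eval t), ← sq_abs (q.eval t), ← sub_nonneg]
        have : √B / (2 * √A) * |p.eval t| ^ 2 + √A / (2 * √B) * |q.eval t| ^ 2
            - |p.eval t| * |q.eval t| =
            (√B * |p.eval t| - √A * |q.eval t|) ^ 2 / (2 * √A * √B) := by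
          field_simp
          ring
        rw [this]
        positivity
    _ = √B / (2 * √A) * gaussianFunctional (p ^ 2) +
        √A / (2 * √B) * gaussianFunctional (q ^ 2) := by
        simp only [hr, map_add, map_smul, smul_eq_mul]
    _ ≤ √B / (2 * √A) * (√A * √A) + √A / (2 * √B) * (√B * √B) := by
        rw [Real.mul_self_sqrt hA.le, Real.mul_self_sqrt hB.le]
        gcongr
    _ = √A * √B := by field_simp; ring

theorem stmt8 (n i : ℕ) (hn : 1 ≤ n) (hi : 1 ≤ i) :
    ∫ s : ℝ, |s| ^ i / (Nat.factorial i : ℝ) * |hermiteFun n s| ≤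
      1 / Real.sqrt ((2 : ℝ) ^ n * (Nat.factorial n : ℝ) * (Nat.factorial i : ℝ) *
        Real.sqrt Real.pi) := by
  set A : ℝ := (Nat.factorial i : ℝ) with hA
  set B : ℝ := (2 : ℝ) ^ n * (Nat.factorial n : ℝ) * √Real.pi with hB
  have hA₀ : 0 < A := by positivity
  have hB₀ : 0 < B := by positivity
  have hfun : ∀ s : ℝ, |s| ^ i / A * |hermiteFun n s| =
      (1 / (A * B)) * (|(Polynomial.X ^ i : Polynomial ℝ).eval s| * |(physHermite n).eval s| *
        Real.exp (-s ^ 2)) := fun s => by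
    rw [hermiteFun, hermiteP_eq_eval, ← hB, abs_mul, abs_mul, Real.abs_exp,
      abs_of_pos (one_div_pos.2 hB₀), Polynomial.eval_pow, Polynomial.eval_X, abs_pow]
    field_simp
  have hRHS : (2 : ℝ) ^ n * (Nat.factorial n : ℝ) * A * √Real.pi = A * B := by
    rw [hB]; ring
  simp only [hfun]
  rw [integral_const_mul, hRHS, Real.sqrt_mul hA₀.le]
  have h := integral_abs_eval_mul_exp_neg_sq_le hA₀ hB₀ (gaussianFunctional_X_pow_sq_le hi)
    (gaussianFunctional_physHermite_sq n).le
  calc _ ≤ 1 / (A * B) * (√A * √B) := by gcongr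
    _ = 1 / (√A * √B) := by
      have ha := Real.sqrt_pos.2 hA₀
      have hb := Real.sqrt_pos.2 hB₀
      nth_rw 1 [← Real.mul_self_sqrt hA₀.le, ← Real.mul_self_sqrt hB₀.le]
      field_simp
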